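/- For the elephant random walk with memory parameter p ∈ [0, 1) on a Cayley graph that is the d-regular tree T_d (d ≥ 3), for any m ≥ 1 and any generator a ∈ S there exists a constant C > 0 such that E|N_n(a)/n − 1/d|^m ≤ C · r_n^{−m} for all n ≥ 1, where r_n = n^{1/2} if p < p_d, r_n = (n / log n)^{1/2} if p = p_d, and r_n = n^{d(1−p)/(d−1)} if p > p_d, with p_d = (d + 1)/(2d). -/

import Mathlib

open MeasureTheory ProbabilityTheory Filter

noncomputable section

/-- The Cayley graph of a group with respect to a finite set of generators. -/
def cayleyGraph {G : Type*} [Group G] (S : Finset G) : SimpleGraph G where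
  Adj x y := x ≠ y ∧ (y * x⁻¹ ∈ S ∨ x * y⁻¹ ∈ S)
  symm := by
    constructor
    rintro x y ⟨h1, h2⟩
    refine ⟨h1.symm, ?_⟩
    rcases h2 with h | h
    · exact Or.inr h
    · exact Or.inl h
  loopless := ⟨fun x h => h.1 rfl⟩

/-- The elephant random walk (ERW) with memory parameter `p` on the Cayley graph of a
group `G` with respect to a symmetric generating set `S` of cardinality `d`, not
containing the identity, whose Cayley graph is a tree (hence the `d`-regular tree
`T_d`).  The steps are `g 1, g 2, …` (the value of `g 0` is irrelevant).  The law of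
the process is characterised by: `g 1` is uniform on `S`, and, conditionally on the
first `n` steps being `s 1, …, s n`, the next step `g (n+1)` equals `a ∈ S` with
probability `p * N/n + ((1-p)/(d-1)) * (n-N)/n`, where `N = #{1 ≤ k ≤ n : s k = a}`;
this is precisely the probability that the walker, recalling a uniform past epoch
`D ∈ {1, …, n}`, repeats `g D` with probability `p` and takes any given other step
with probability `(1-p)/(d-1)`. -/
structure ERW (G : Type*) [Group G] [DecidableEq G] (d : ℕ) (p : ℝ)
    (Ω : Type*) [MeasurableSpace Ω] (P : Measure Ω) where
  S : Finset G
  card_S : S.card = d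
  symm_S : ∀ s ∈ S, s⁻¹ ∈ S
  one_not_mem : (1 : G) ∉ S
  tree : (cayleyGraph S).IsTree
  g : ℕ → Ω → G
  meas_g : ∀ n a, MeasurableSet {ω | g n ω = a}
  mem_S : ∀ n, 1 ≤ n → ∀ ω, g n ω ∈ S
  init : ∀ a ∈ S, (P {ω | g 1 ω = a}).toReal = 1 / d
  update : ∀ n, 1 ≤ n → ∀ s : ℕ → G, ∀ a ∈ S,
    (P ({ω | ∀ k ∈ Finset.Icc 1 n, g k ω = s k} ∩ {ω | g (n + 1) ω = a})).toReal
      = (p * ((((Finset.Icc 1 n).filter fun k => s k = a).card : ℝ) / n)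
          + (1 - p) / ((d : ℝ) - 1)
            * (((n : ℝ) - (((Finset.Icc 1 n).filter fun k => s k = a).card : ℝ)) / n))
        * (P {ω | ∀ k ∈ Finset.Icc 1 n, g k ω = s k}).toReal

namespace ERW

variable {G : Type*} [Group G] [DecidableEq G] {d : ℕ} {p : ℝ}
  {Ω : Type*} [MeasurableSpace Ω] {P : Measure Ω}

/-- The position `w n = g n ⋯ g 1` of the walk at time `n`. -/
def pos (E : ERW G d p Ω P) : ℕ → Ω → G
  | 0 => fun _ => 1
  | n + 1 => fun ω => E.g (n + 1) ω * E.pos n ω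

/-- `Δ n`: the (word-metric) distance of the walker from the root at time `n`. -/
def dist (E : ERW G d p Ω P) (n : ℕ) (ω : Ω) : ℕ :=
  (cayleyGraph E.S).dist 1 (E.pos n ω)

/-- `N n a`: the number of `a`-steps taken by time `n`. -/
def count (E : ERW G d p Ω P) (a : G) (n : ℕ) (ω : Ω) : ℕ :=
  ((Finset.Icc 1 n).filter fun k => E.g k ω = a).card

/-- `γ n`: the unique step decreasing the distance to the root by 1
(a junk value if the walker is at the root). -/
def gammaStep (E : ERW G d p Ω P) (n : ℕ) (ω : Ω) : G :=
  @Classical.epsilon G ⟨1⟩ fun s =>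
    s ∈ E.S ∧ (cayleyGraph E.S).dist 1 (s * E.pos n ω) + 1 = E.dist n ω

/-- `ℓ n = N n (γ n)` if the walker is away from the root, and `0` otherwise. -/
def ell (E : ERW G d p Ω P) (n : ℕ) (ω : Ω) : ℕ :=
  if E.pos n ω = 1 then 0 else E.count (E.gammaStep n ω) n ω

/-- `Ξ n = (1/n) ∑_{k=0}^{n-1} (ℓ k / k - 1(Δ k > 0)/d)` (with the convention
`ℓ 0 / 0 = 0`, automatic since division by zero yields zero). -/
def Xi (E : ERW G d p Ω P) (n : ℕ) (ω : Ω) : ℝ :=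
  (1 / n) * ∑ k ∈ Finset.range n,
    ((E.ell k ω : ℝ) / k - (if 0 < E.dist k ω then 1 else 0) / d)

/-- The natural filtration `F n` generated by the steps up to time `n`. -/
def filt (E : ERW G d p Ω P) (n : ℕ) : MeasurableSpace Ω :=
  ⨆ k ∈ Finset.Icc 1 n, MeasurableSpace.comap (E.g k) ⊤

/-- `G n = E[Δ (n+1) - Δ n | F n]`. -/
def drift (E : ERW G d p Ω P) (n : ℕ) : Ω → ℝ :=
  P[fun ω => ((E.dist (n + 1) ω : ℝ) - (E.dist n ω : ℝ)) | E.filt n]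

/-- The martingale differences `Y k = Δ k - Δ (k-1) - G (k-1)`. -/
def mdiff (E : ERW G d p Ω P) (k : ℕ) (ω : Ω) : ℝ :=
  (E.dist k ω : ℝ) - (E.dist (k - 1) ω : ℝ) - E.drift (k - 1) ω

/-- The martingale `M n = ∑_{k=1}^n Y k`. -/
def mart (E : ERW G d p Ω P) (n : ℕ) (ω : Ω) : ℝ :=
  ∑ k ∈ Finset.Icc 1 n, E.mdiff k ω

end ERW

/-- The rate `r n`: `√n` in the subcritical regime `p < p_d = (d+1)/(2d)`,
`√(n / log n)` in the critical regime `p = p_d`, and `n ^ (d(1-p)/(d-1))` in the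
supercritical regime `p > p_d`. -/
def rate (p : ℝ) (d : ℕ) (n : ℕ) : ℝ :=
  if p < ((d : ℝ) + 1) / (2 * d) then Real.sqrt n
  else if p = ((d : ℝ) + 1) / (2 * d) then Real.sqrt ((n : ℝ) / Real.log n)
  else (n : ℝ) ^ ((d : ℝ) * (1 - p) / ((d : ℝ) - 1))


theorem aux_taylor (i : ℕ) : ∃ C : ℝ, 0 < C ∧ ∀ x y : ℝ, |y| ≤ 1 →
    |(x + y) ^ (i + 2) - x ^ (i + 2) - (i + 2) * x ^ (i + 1) * y| ≤ C * (|x| ^ i + 1) := by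
  induction i with
  | zero =>
    refine ⟨1, one_pos, fun x y hy => ?_⟩
    have h : (x + y) ^ (0 + 2) - x ^ (0 + 2) - ((0 : ℕ) + 2) * x ^ (0 + 1) * y = y ^ 2 := by
      push_cast; ring
    rw [h, abs_pow]
    have := abs_nonneg y
    simp only [pow_zero]
    nlinarith
  | succ i ih =>
    obtain ⟨C, hC, ih⟩ := ih
    refine ⟨4 * C + (i + 2), by positivity, fun x y hy => ?_⟩
    have h := ih x y hy
    set R := (x + y) ^ (i + 2) - x ^ (i + 2) - (i + 2) * x ^ (i + 1) * y with hR
    have e : (x + y) ^ (i + 1 + 2) - x ^ (i + 1 + 2) - ((i + 1 : ℕ) + 2) * x ^ (i + 1 + 1) * y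
        = (x + y) * R + (i + 2) * x ^ (i + 1) * y ^ 2 := by
      rw [hR]; push_cast; ring
    rw [e]
    have hx := abs_nonneg x
    have h1 : |x + y| ≤ |x| + 1 := (abs_add_le x y).trans (by linarith)
    have h2 : |(x + y) * R| ≤ (|x| + 1) * (C * (|x| ^ i + 1)) := by
      rw [abs_mul]
      exact mul_le_mul h1 h (abs_nonneg _) (by positivity)
    have h3 : |((i : ℝ) + 2) * x ^ (i + 1) * y ^ 2| ≤ (i + 2) * |x| ^ (i + 1) := by
      rw [abs_mul, abs_mul, abs_pow, abs_pow, abs_of_nonneg (by positivity : (0 : ℝ) ≤ (i : ℝ) + 2)]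
      exact mul_le_of_le_one_right (by positivity) (pow_le_one₀ (abs_nonneg _) hy)
    have h4 : |x| ≤ |x| ^ (i + 1) + 1 := by
      rcases le_total |x| 1 with h | h
      · have : 0 ≤ |x| ^ (i + 1) := by positivity
        linarith
      · have := le_self_pow₀ h (Nat.succ_ne_zero i)
        simp only [Nat.succ_eq_add_one] at this
        linarith
    have h5 : |x| ^ i ≤ |x| ^ (i + 1) + 1 := by
      rcases le_total |x| 1 with h | h
      · have : |x| ^ i ≤ 1 := pow_le_one₀ hx h
        have : 0 ≤ |x| ^ (i + 1) := by positivity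
        linarith
      · have := pow_le_pow_right₀ h (Nat.le_succ i)
        simp only [Nat.succ_eq_add_one] at this
        linarith
    have h6 : (|x| + 1) * (C * (|x| ^ i + 1)) ≤ 4 * C * (|x| ^ (i + 1) + 1) := by
      have : (|x| + 1) * (C * (|x| ^ i + 1)) = C * (|x| ^ (i + 1) + |x| + |x| ^ i + 1) := by ring
      rw [this, mul_comm 4 C, mul_assoc]
      have : 0 ≤ |x| ^ (i + 1) := by positivity
      exact mul_le_mul_of_nonneg_left (by linarith) hC.le
    have h7 := abs_add_le ((x + y) * R) (((i : ℝ) + 2) * x ^ (i + 1) * y ^ 2)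
    have h8 : (0 : ℝ) ≤ (i : ℝ) + 2 := by positivity
    linarith

namespace ERW

section aux

variable {G : Type*} [Group G] [DecidableEq G] {d : ℕ} {p : ℝ}
  {Ω : Type*} [MeasurableSpace Ω] {P : Measure Ω}

/-- indicator of `g n = a` -/
def ind (E : ERW G d p Ω P) (a : G) (n : ℕ) (ω : Ω) : ℝ := if E.g n ω = a then 1 else 0

theorem measurable_ind (E : ERW G d p Ω P) (a : G) (n : ℕ) : Measurable (E.ind a n) :=
  Measurable.ite (E.meas_g n a) measurable_const measurable_const

theorem measurable_count (E : ERW G d p Ω P) (a : G) (n : ℕ) : Measurable (E.count a n) := by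
  have : E.count a n = fun ω => ∑ k ∈ Finset.Icc 1 n, if E.g k ω = a then 1 else 0 := by
    funext ω
    simp only [count, Finset.card_filter]
  rw [this]
  exact Finset.measurable_sum _ fun k _ =>
    Measurable.ite (E.meas_g k a) measurable_const measurable_const

theorem count_le (E : ERW G d p Ω P) (a : G) (n : ℕ) (ω : Ω) : E.count a n ω ≤ n := by
  have := Finset.card_filter_le (Finset.Icc 1 n) (fun k => E.g k ω = a)
  simpa [count] using this

theorem count_succ (E : ERW G d p Ω P) (a : G) (n : ℕ) (ω : Ω) :
    (E.count a (n + 1) ω : ℝ) = E.count a n ω + E.ind a (n + 1) ω := by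
  simp only [count, ind, Finset.card_filter]
  rw [Finset.sum_Icc_succ_top (by omega)]
  push_cast
  rfl

theorem integrable_count [IsProbabilityMeasure P] (E : ERW G d p Ω P) (a : G) (n : ℕ)
    (F : ℕ → ℝ) : Integrable (fun ω => F (E.count a n ω)) P := by
  refine Integrable.of_bound
    ((measurable_from_nat (f := F)).comp (E.measurable_count a n)).aestronglyMeasurable
    (∑ j ∈ Finset.range (n + 1), |F j|) (ae_of_all _ fun ω => ?_)
  rw [Real.norm_eq_abs]
  exact Finset.single_le_sum (f := fun j => |F j|) (fun _ _ => abs_nonneg _)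
    (Finset.mem_range.2 (Nat.lt_succ_of_le (E.count_le a n ω)))

theorem integrable_count_ind [IsProbabilityMeasure P] (E : ERW G d p Ω P) (a : G) (n : ℕ)
    (F : ℕ → ℝ) : Integrable (fun ω => F (E.count a n ω) * E.ind a (n + 1) ω) P := by
  refine (E.integrable_count a n F).mul_bdd (c := 1)
    (E.measurable_ind a (n + 1)).aestronglyMeasurable (ae_of_all _ fun ω => ?_)
  unfold ind
  split_ifs <;> simp

/-- extension of a finite path -/
def extPath (E : ERW G d p Ω P) {n : ℕ} (t : Finset.Icc 1 n → E.S) (k : ℕ) : G :=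
  if h : k ∈ Finset.Icc 1 n then (t ⟨k, h⟩ : G) else 1

/-- the cylinder of a path -/
def cyl (E : ERW G d p Ω P) (n : ℕ) (s : ℕ → G) : Set Ω :=
  {ω | ∀ k ∈ Finset.Icc 1 n, E.g k ω = s k}

theorem measurableSet_cyl (E : ERW G d p Ω P) (n : ℕ) (s : ℕ → G) :
    MeasurableSet (E.cyl n s) := by
  have : E.cyl n s = ⋂ k ∈ Finset.Icc 1 n, {ω | E.g k ω = s k} := by
    ext ω; simp [cyl]
  rw [this]
  exact Finset.measurableSet_biInter _ fun k _ => E.meas_g k _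

/-- counts along a path -/
def cnt (a : G) (n : ℕ) (s : ℕ → G) : ℕ := ((Finset.Icc 1 n).filter fun k => s k = a).card

theorem count_eq_of_mem_cyl (E : ERW G d p Ω P) (a : G) (n : ℕ) (s : ℕ → G) (ω : Ω)
    (h : ω ∈ E.cyl n s) : E.count a n ω = cnt a n s := by
  unfold count cnt
  congr 1
  apply Finset.filter_congr
  intro k hk
  rw [h k hk]

open Classical in
theorem decomp (E : ERW G d p Ω P) (a : G) (n : ℕ) (F : ℕ → ℝ) (ω : Ω) :
    F (E.count a n ω) = ∑ t : Finset.Icc 1 n → E.S,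
      F (cnt a n (E.extPath t)) * (E.cyl n (E.extPath t)).indicator 1 ω := by
  let t₀ : Finset.Icc 1 n → E.S := fun k => ⟨E.g k ω, E.mem_S k (Finset.mem_Icc.1 k.2).1 ω⟩
  have h0 : ω ∈ E.cyl n (E.extPath t₀) := by
    intro k hk
    simp only [extPath, hk, dif_pos, t₀]
  rw [Finset.sum_eq_single t₀]
  · rw [Set.indicator_of_mem h0, E.count_eq_of_mem_cyl a n _ ω h0]; simp
  · intro t _ hne
    rw [Set.indicator_of_notMem, mul_zero]
    intro hmem
    apply hne
    funext k
    have := hmem k.1 k.2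
    simp only [extPath, k.2, dif_pos] at this
    apply Subtype.ext
    exact this.symm
  · intro h; exact absurd (Finset.mem_univ _) h

/-- transition probability -/
def q (d : ℕ) (p : ℝ) (n : ℕ) (j : ℕ) : ℝ :=
  p * ((j : ℝ) / n) + (1 - p) / ((d : ℝ) - 1) * (((n : ℝ) - j) / n)

theorem integral_step [IsProbabilityMeasure P] (E : ERW G d p Ω P) (a : G) (ha : a ∈ E.S)
    (n : ℕ) (hn : 1 ≤ n) (F : ℕ → ℝ) :
    ∫ ω, F (E.count a n ω) * E.ind a (n + 1) ω ∂P
      = ∫ ω, F (E.count a n ω) * q d p n (E.count a n ω) ∂P := by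
  classical
  have e1 : ∀ ω, F (E.count a n ω) * E.ind a (n + 1) ω = ∑ t : Finset.Icc 1 n → E.S,
      F (cnt a n (E.extPath t)) *
        (E.cyl n (E.extPath t) ∩ {ω | E.g (n + 1) ω = a}).indicator 1 ω := by
    intro ω
    rw [E.decomp a n F ω, Finset.sum_mul]
    refine Finset.sum_congr rfl fun t _ => ?_
    rw [mul_assoc, Set.inter_indicator_one]
    congr 1
    simp only [Pi.mul_apply]
    congr 1
    simp [ind, Set.indicator_apply]
  have e2 := E.decomp a n (fun j => F j * q d p n j)
  simp_rw [e1, e2]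
  rw [integral_finset_sum, integral_finset_sum]
  · refine Finset.sum_congr rfl fun t _ => ?_
    rw [integral_const_mul, integral_const_mul,
      integral_indicator_one ((E.measurableSet_cyl n _).inter (E.meas_g _ _)),
      integral_indicator_one (E.measurableSet_cyl n _)]
    have := E.update n hn (E.extPath t) a ha
    rw [mul_assoc]
    congr 1
  · intro t _
    exact ((integrable_const (1 : ℝ)).indicator (E.measurableSet_cyl n _)).const_mul _
  · intro t _
    exact ((integrable_const (1 : ℝ)).indicator
      ((E.measurableSet_cyl n _).inter (E.meas_g _ _))).const_mul _

/-- the centred count -/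
def X (E : ERW G d p Ω P) (a : G) (n : ℕ) (ω : Ω) : ℝ := (E.count a n ω : ℝ) - n / d

theorem integrable_X [IsProbabilityMeasure P] (E : ERW G d p Ω P) (a : G) (n : ℕ)
    (F : ℝ → ℝ) : Integrable (fun ω => F (E.X a n ω)) P :=
  E.integrable_count a n (fun j => F ((j : ℝ) - n / d))

theorem moment_step [IsProbabilityMeasure P] (hd : 3 ≤ d) (E : ERW G d p Ω P)
    (a : G) (ha : a ∈ E.S) (j : ℕ) : ∃ C : ℝ, 0 < C ∧ ∀ n : ℕ, 1 ≤ n →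
      ∫ ω, E.X a (n + 1) ω ^ (2 * j + 2) ∂P ≤
        (1 + (2 * j + 2) * ((p * d - 1) / (d - 1)) / n) * ∫ ω, E.X a n ω ^ (2 * j + 2) ∂P
        + C * (∫ ω, E.X a n ω ^ (2 * j) ∂P + 1) := by
  obtain ⟨C, hC, hT⟩ := aux_taylor (2 * j)
  refine ⟨C, hC, fun n hn => ?_⟩
  have hd' : (3 : ℝ) ≤ d := by exact_mod_cast hd
  have hn' : (1 : ℝ) ≤ n := by exact_mod_cast hn
  have hpt : ∀ ω, E.X a (n + 1) ω ^ (2 * j + 2) ≤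
      E.X a n ω ^ (2 * j + 2) + (2 * j + 2) * (E.X a n ω ^ (2 * j + 1) * E.ind a (n + 1) ω)
       - (2 * j + 2) / d * E.X a n ω ^ (2 * j + 1)
       + C * (E.X a n ω ^ (2 * j) + 1) := by
    intro ω
    have hX : E.X a (n + 1) ω = E.X a n ω + (E.ind a (n + 1) ω - 1 / d) := by
      simp only [X, E.count_succ]; push_cast; ring
    have h1 : (0 : ℝ) < 1 / d := by positivity
    have h2 : (1 : ℝ) / d ≤ 1 := by rw [div_le_one (by linarith)]; linarith
    have hy : |E.ind a (n + 1) ω - 1 / d| ≤ 1 := by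
      rw [abs_le]
      unfold ind
      split_ifs <;> constructor <;> linarith
    have h := (abs_le.1 (hT (E.X a n ω) _ hy)).2
    rw [← hX, (even_two_mul j).pow_abs] at h
    push_cast at h
    have e : (2 * (j : ℝ) + 2) / d * E.X a n ω ^ (2 * j + 1)
      = (2 * j + 2) * E.X a n ω ^ (2 * j + 1) * (1 / d) := by ring
    rw [e]
    linarith
  have i1 := E.integrable_X a n (fun x => x ^ (2 * j + 2))
  have i2 : Integrable (fun ω => E.X a n ω ^ (2 * j + 1) * E.ind a (n + 1) ω) P :=
    E.integrable_count_ind a n (fun i => ((i : ℝ) - n / d) ^ (2 * j + 1))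
  have i3 := E.integrable_X a n (fun x => x ^ (2 * j + 1))
  have i4 := E.integrable_X a n (fun x => x ^ (2 * j))
  have i4' : Integrable (fun ω => C * (E.X a n ω ^ (2 * j) + 1)) P :=
    (i4.add (integrable_const (1 : ℝ))).const_mul C
  have s1 : Integrable (fun ω => E.X a n ω ^ (2 * j + 2)
      + (2 * j + 2) * (E.X a n ω ^ (2 * j + 1) * E.ind a (n + 1) ω)) P :=
    i1.add (i2.const_mul (2 * j + 2))
  have s2 : Integrable (fun ω => E.X a n ω ^ (2 * j + 2)
      + (2 * j + 2) * (E.X a n ω ^ (2 * j + 1) * E.ind a (n + 1) ω)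
      - (2 * j + 2) / d * E.X a n ω ^ (2 * j + 1)) P :=
    s1.sub (i3.const_mul ((2 * j + 2) / d))
  have hI := integral_mono (E.integrable_X a (n + 1) (fun x => x ^ (2 * j + 2)))
    (s2.add i4') hpt
  simp only [Pi.add_apply] at hI
  rw [integral_add s2 i4', integral_sub s1 (i3.const_mul _),
    integral_add i1 (i2.const_mul _), integral_const_mul, integral_const_mul,
    integral_const_mul, integral_add i4 (integrable_const _)] at hI
  simp only [integral_const, probReal_univ, smul_eq_mul, mul_one] at hI
  have hs : ∫ ω, E.X a n ω ^ (2 * j + 1) * E.ind a (n + 1) ω ∂P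
      = (1 / d) * ∫ ω, E.X a n ω ^ (2 * j + 1) ∂P
        + ((p * d - 1) / (d - 1)) / n * ∫ ω, E.X a n ω ^ (2 * j + 2) ∂P := by
    have := E.integral_step a ha n hn (fun i => ((i : ℝ) - n / d) ^ (2 * j + 1))
    refine this.trans ?_
    rw [← integral_const_mul, ← integral_const_mul, ← integral_add (i3.const_mul _) (i1.const_mul _)]
    congr 1
    funext ω
    simp only [X, q]
    have hd1 : (d : ℝ) - 1 ≠ 0 := by linarith
    have hd0 : (d : ℝ) ≠ 0 := by linarith
    have hn0 : (n : ℝ) ≠ 0 := by linarith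
    set c : ℝ := (E.count a n ω : ℝ)
    have : p * (c / n) + (1 - p) / ((d : ℝ) - 1) * (((n : ℝ) - c) / n)
      = 1 / d + ((p * d - 1) / (d - 1)) / n * (c - n / d) := by
      field_simp; ring
    rw [this]; ring
  rw [hs] at hI
  refine hI.trans (le_of_eq ?_)
  ring

theorem moment_bound [IsProbabilityMeasure P] (hd : 3 ≤ d) (E : ERW G d p Ω P)
    (a : G) (ha : a ∈ E.S) (v : ℕ → ℝ) (c b : ℝ) (hc : 0 < c) (hb0 : 0 ≤ b)
    (hb : (p * d - 1) / (d - 1) ≤ b)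
    (hv1 : ∀ n, 1 ≤ n → 1 ≤ v n)
    (hv : ∀ n : ℕ, 1 ≤ n → v n * (1 + 2 * b / n) + c ≤ v (n + 1)) (k : ℕ) :
    ∃ A : ℝ, 0 < A ∧ ∀ n : ℕ, 1 ≤ n → ∫ ω, E.X a n ω ^ (2 * k) ∂P ≤ A * v n ^ k := by
  induction k with
  | zero => exact ⟨1, one_pos, fun n hn => by simp⟩
  | succ j ih =>
    obtain ⟨A, hA, ih⟩ := ih
    obtain ⟨C, hC, hstep⟩ := E.moment_step hd a ha j
    have hd' : (3 : ℝ) ≤ d := by exact_mod_cast hd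
    refine ⟨1 + C * (A + 1) / ((j + 1) * c), by positivity, fun n hn => ?_⟩
    set B := 1 + C * (A + 1) / ((j + 1) * c) with hB
    have hB1 : 1 ≤ B := by
      have : 0 ≤ C * (A + 1) / ((j + 1) * c) := by positivity
      linarith
    have hBc : C * (A + 1) ≤ B * ((j + 1) * c) := by
      rw [hB, add_mul, div_mul_cancel₀ _ (by positivity)]
      have : 0 ≤ 1 * (((j : ℝ) + 1) * c) := by positivity
      linarith
    induction n, hn using Nat.le_induction with
    | base =>
      have h1 : ∀ ω, E.X a 1 ω ^ (2 * (j + 1)) ≤ 1 := by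
        intro ω
        rw [← (even_two_mul (j + 1)).pow_abs]
        refine pow_le_one₀ (abs_nonneg _) ?_
        have h0 : (E.count a 1 ω : ℝ) ≤ 1 := by exact_mod_cast E.count_le a 1 ω
        have h0' : (0 : ℝ) ≤ E.count a 1 ω := by positivity
        have h1 : (0 : ℝ) < 1 / d := by positivity
        have h2 : (1 : ℝ) / d ≤ 1 := by rw [div_le_one (by linarith)]; linarith
        simp only [X, Nat.cast_one]
        rw [abs_le]; constructor <;> linarith
      have := integral_mono (E.integrable_X a 1 (fun x => x ^ (2 * (j + 1))))
        (integrable_const (μ := P) (1 : ℝ)) h1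
      simp only [integral_const, probReal_univ, smul_eq_mul, mul_one] at this
      have h2 : 1 ≤ v 1 ^ (j + 1) := one_le_pow₀ (hv1 1 le_rfl)
      nlinarith
    | succ n hn ih2 =>
      have hn' : (1 : ℝ) ≤ n := by exact_mod_cast hn
      have hs := hstep n hn
      have hi := ih n hn
      have hvn := hv1 n hn
      have hV : 1 ≤ v n ^ j := one_le_pow₀ hvn
      have e : 2 * (j + 1) = 2 * j + 2 := by ring
      rw [e] at ih2 ⊢
      have hpos : 0 ≤ ∫ ω, E.X a n ω ^ (2 * j + 2) ∂P :=
        integral_nonneg fun ω => (by rw [← e]; exact (even_two_mul _).pow_nonneg _)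
      set I := ∫ ω, E.X a n ω ^ (2 * j + 2) ∂P
      set J := ∫ ω, E.X a n ω ^ (2 * j) ∂P
      have hα : (1 + (2 * j + 2) * ((p * d - 1) / (d - 1)) / n) * I
          ≤ (1 + (2 * j + 2) * b / n) * (B * v n ^ (j + 1)) := by
        calc _ ≤ (1 + (2 * j + 2) * b / n) * I := by
              refine mul_le_mul_of_nonneg_right ?_ hpos
              gcongr
          _ ≤ _ := mul_le_mul_of_nonneg_left ih2 (by positivity)
      have hJ : C * (J + 1) ≤ C * (A + 1) * v n ^ j := by
        rw [mul_assoc]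
        refine mul_le_mul_of_nonneg_left ?_ hC.le
        linarith
      have hJ2 : C * (A + 1) * v n ^ j ≤ B * ((j + 1) * c) * v n ^ j :=
        mul_le_mul_of_nonneg_right hBc (by positivity)
      -- Bernoulli
      have hv0 : 0 < v n := by linarith
      have hbern : v n ^ (j + 1) * (1 + (j + 1) * (2 * b / n + c / v n)) ≤ v (n + 1) ^ (j + 1) := by
        have h1 := one_add_mul_le_pow (a := 2 * b / n + c / v n)
          (by have : 0 ≤ 2 * b / n + c / v n := by positivity
              linarith) (j + 1)
        push_cast at h1
        calc _ ≤ v n ^ (j + 1) * (1 + (2 * b / n + c / v n)) ^ (j + 1) :=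
              mul_le_mul_of_nonneg_left h1 (by positivity)
          _ = (v n * (1 + 2 * b / n) + c) ^ (j + 1) := by
              rw [← mul_pow]; congr 1; field_simp; ring
          _ ≤ _ := pow_le_pow_left₀ (by positivity) (hv n hn) _
      have hfin : (1 + (2 * j + 2) * b / n) * (B * v n ^ (j + 1)) + B * ((j + 1) * c) * v n ^ j
          = B * (v n ^ (j + 1) * (1 + (j + 1) * (2 * b / n + c / v n))) := by
        field_simp
        ring
      have := mul_le_mul_of_nonneg_left hbern (by linarith : 0 ≤ B)
      linarith

end aux

end ERW

theorem exists_v (d : ℕ) (hd : 3 ≤ d) (p : ℝ) (hp0 : 0 ≤ p) (hp1 : p < 1) :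
    ∃ (v : ℕ → ℝ) (c b K : ℝ), 0 < c ∧ 0 ≤ b ∧ (p * d - 1) / (d - 1) ≤ b ∧ 0 < K ∧
      (∀ n, 1 ≤ n → 1 ≤ v n) ∧
      (∀ n : ℕ, 1 ≤ n → v n * (1 + 2 * b / n) + c ≤ v (n + 1)) ∧
      (∀ n : ℕ, 1 ≤ n → 0 ≤ rate p d n ∧ rate p d n ^ 2 * v n ≤ K * n ^ 2) := by
  have hd' : (3 : ℝ) ≤ d := by exact_mod_cast hd
  have hd1 : (0 : ℝ) < (d : ℝ) - 1 := by linarith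
  rcases lt_trichotomy p (((d : ℝ) + 1) / (2 * d)) with h | h | h
  · have hα : (p * d - 1) / (d - 1) < 1 / 2 := by
      rw [lt_div_iff₀ (by positivity)] at h
      rw [div_lt_iff₀ hd1]; linarith
    set b := max 0 ((p * d - 1) / ((d : ℝ) - 1)) with hbdef
    have hb : b < 1 / 2 := max_lt (by norm_num) hα
    refine ⟨fun n => n, 1 - 2 * b, b, 1, by linarith, le_max_left _ _, le_max_right _ _,
      one_pos, fun n hn => Nat.one_le_cast.2 hn, fun n hn => ?_, fun n hn => ?_⟩
    · have hn' : (1 : ℝ) ≤ n := by exact_mod_cast hn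
      refine le_of_eq ?_
      push_cast; field_simp; ring
    · simp only [rate, if_pos h]
      refine ⟨Real.sqrt_nonneg _, ?_⟩
      rw [Real.sq_sqrt (by positivity)]
      refine le_of_eq (by ring)
  · have hα : (p * d - 1) / (d - 1) = 1 / 2 := by
      rw [h]; field_simp; ring
    refine ⟨fun n => n * (1 + Real.log n), 1, 1 / 2, 1 + (Real.log 2)⁻¹, one_pos, by norm_num,
      hα.le, by have := Real.log_pos one_lt_two; positivity, fun n hn => ?_, fun n hn => ?_,
      fun n hn => ?_⟩
    · have hn' : (1 : ℝ) ≤ n := by exact_mod_cast hn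
      have := Real.log_nonneg hn'
      nlinarith
    · have hn' : (1 : ℝ) ≤ n := by exact_mod_cast hn
      have h1 := Real.one_sub_inv_le_log_of_pos (x := ((n : ℝ) + 1) / n) (by positivity)
      rw [Real.log_div (by positivity) (by positivity), inv_div] at h1
      have h2 : 1 - (n : ℝ) / (n + 1) = 1 / (n + 1) := by field_simp; ring
      rw [h2, div_le_iff₀ (by positivity)] at h1
      have h3 : (n : ℝ) * (1 + Real.log n) * (1 + 2 * (1 / 2) / n)
        = (n + 1) * (1 + Real.log n) := by field_simp
      rw [h3]; push_cast; linarith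
    · have hn' : (1 : ℝ) ≤ n := by exact_mod_cast hn
      have hl2 := Real.log_pos one_lt_two
      simp only [rate, if_neg h.not_lt, if_pos h]
      refine ⟨Real.sqrt_nonneg _, ?_⟩
      rw [Real.sq_sqrt (div_nonneg (by positivity) (Real.log_nonneg hn'))]
      rcases hn.eq_or_lt with rfl | hn2
      · simp; positivity
      · have hl : Real.log 2 ≤ Real.log n :=
          Real.log_le_log (by norm_num) (by exact_mod_cast hn2)
        have hlp : 0 < Real.log n := by linarith
        have : (n : ℝ) / Real.log n * (n * (1 + Real.log n))
          = (1 + (Real.log n)⁻¹) * n ^ 2 := by field_simp; ring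
        rw [this]
        gcongr
  · have hα : 1 / 2 < (p * d - 1) / (d - 1) := by
      rw [div_lt_iff₀ (by positivity)] at h
      rw [lt_div_iff₀ hd1]; linarith
    set b := (p * d - 1) / ((d : ℝ) - 1) with hbdef
    have hv1 : ∀ n : ℕ, 1 ≤ n → (n : ℝ) ≤ (n : ℝ) ^ (2 * b) := fun n hn => by
      have hn' : (1 : ℝ) ≤ n := by exact_mod_cast hn
      exact Real.self_le_rpow_of_one_le hn' (by linarith)
    refine ⟨fun n => 2 * (n : ℝ) ^ (2 * b) - n, 2 * b - 1, b, 2, by linarith, by linarith,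
      le_rfl, by norm_num, fun n hn => ?_, fun n hn => ?_, fun n hn => ?_⟩
    · have hn' : (1 : ℝ) ≤ n := by exact_mod_cast hn
      have := hv1 n hn
      simp only
      linarith
    · have hn' : (1 : ℝ) ≤ n := by exact_mod_cast hn
      have h1 := one_add_mul_self_le_rpow_one_add (s := 1 / (n : ℝ)) (p := 2 * b)
        (by have : 0 ≤ 1 / (n : ℝ) := by positivity
            linarith) (by linarith)
      have h2 : ((n + 1 : ℕ) : ℝ) ^ (2 * b) = (n : ℝ) ^ (2 * b) * (1 + 1 / n) ^ (2 * b) := by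
        rw [← Real.mul_rpow (by positivity) (by positivity)]
        congr 1; push_cast; field_simp
      simp only
      rw [h2]
      have h3 := mul_le_mul_of_nonneg_left h1 (by positivity : 0 ≤ (n : ℝ) ^ (2 * b))
      have h4 : (2 * (n : ℝ) ^ (2 * b) - n) * (1 + 2 * b / n)
        = 2 * ((n : ℝ) ^ (2 * b) * (1 + 2 * b * (1 / n))) - n - 2 * b := by
        field_simp
        ring
      rw [h4]; push_cast; linarith
    · have hn' : (1 : ℝ) ≤ n := by exact_mod_cast hn
      have hn0 : (0 : ℝ) < n := by linarith
      simp only [rate, if_neg h.le.not_gt, if_neg h.ne']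
      refine ⟨by positivity, ?_⟩
      have hexp : (d : ℝ) * (1 - p) / (d - 1) = 1 - b := by
        rw [hbdef]; field_simp; ring
      rw [hexp]
      have h1 : ((n : ℝ) ^ (1 - b)) ^ 2 * (n : ℝ) ^ (2 * b) = n ^ 2 := by
        rw [← Real.rpow_natCast ((n : ℝ) ^ (1 - b)), ← Real.rpow_mul hn0.le,
          ← Real.rpow_add hn0, ← Real.rpow_natCast]
        congr 1; push_cast; ring
      have h2 : 0 ≤ ((n : ℝ) ^ (1 - b)) ^ 2 := by positivity
      nlinarith [mul_nonneg h2 hn0.le]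

/-- urn concentration: for any `m ≥ 1` and any generator `a ∈ S`
there is `C > 0` with `E|N n a / n - 1/d|^m ≤ C * r n ^ (-m)` for all `n ≥ 1`
(stated in the equivalent product form `r n ^ m * E|⋯|^m ≤ C`). -/
theorem erw_step_count_moments
    {G : Type*} [Group G] [DecidableEq G] {Ω : Type*} [MeasurableSpace Ω]
    {P : Measure Ω} [IsProbabilityMeasure P]
    (d : ℕ) (hd : 3 ≤ d) (p : ℝ) (hp0 : 0 ≤ p) (hp1 : p < 1)
    (E : ERW G d p Ω P) (m : ℝ) (hm : 1 ≤ m) :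
    ∀ a ∈ E.S, ∃ C : ℝ, 0 < C ∧ ∀ n : ℕ, 1 ≤ n →
      rate p d n ^ m *
        ∫ ω, |(E.count a n ω : ℝ) / n - 1 / d| ^ m ∂P ≤ C := by
  intro a ha
  obtain ⟨v, c, b, K, hc, hb0, hb, hK, hv1, hv, hr⟩ := exists_v d hd p hp0 hp1
  obtain ⟨k, hk⟩ := exists_nat_ge m
  obtain ⟨A, hA, hmom⟩ := E.moment_bound hd a ha v c b hc hb0 hb hv1 hv k
  refine ⟨K ^ (m / 2) * (1 + A), by positivity, fun n hn => ?_⟩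
  obtain ⟨hr0, hrn⟩ := hr n hn
  have hn' : (1 : ℝ) ≤ n := by exact_mod_cast hn
  have hvn : 0 < v n := by linarith [hv1 n hn]
  have hpt : ∀ ω, rate p d n ^ m * |(E.count a n ω : ℝ) / n - 1 / d| ^ m
      ≤ K ^ (m / 2) * (1 + (v n ^ k)⁻¹ * E.X a n ω ^ (2 * k)) := by
    intro ω
    set y := |E.X a n ω| / Real.sqrt (v n) with hy
    have hy0 : 0 ≤ y := by positivity
    have hd' : (3 : ℝ) ≤ d := by exact_mod_cast hd
    have e1 : (E.count a n ω : ℝ) / n - 1 / d = E.X a n ω / n := by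
      simp only [ERW.X]; field_simp
    have hsv : 0 < Real.sqrt (v n) := Real.sqrt_pos.2 hvn
    have e2 : rate p d n * |(E.count a n ω : ℝ) / n - 1 / d| ≤ Real.sqrt K * y := by
      rw [e1, abs_div, abs_of_pos (by linarith : (0 : ℝ) < n), hy]
      have h1 : rate p d n * Real.sqrt (v n) ≤ Real.sqrt K * n := by
        refine (sq_le_sq₀ (by positivity) (by positivity)).1 ?_
        rw [mul_pow, mul_pow, Real.sq_sqrt hvn.le, Real.sq_sqrt hK.le]
        exact hrn
      rw [← mul_div_assoc, ← mul_div_assoc, div_le_div_iff₀ (by linarith) hsv]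
      have := mul_le_mul_of_nonneg_right h1 (abs_nonneg (E.X a n ω))
      linarith
    have e3 : y ^ m ≤ 1 + y ^ (2 * k) := by
      rcases le_total y 1 with h | h
      · have : y ^ m ≤ 1 := Real.rpow_le_one hy0 h (by linarith)
        have : 0 ≤ y ^ (2 * k) := by positivity
        linarith
      · have : y ^ m ≤ y ^ ((2 * k : ℕ) : ℝ) := by
          refine Real.rpow_le_rpow_of_exponent_le h ?_
          push_cast; linarith
        rw [Real.rpow_natCast] at this
        linarith
    have e4 : y ^ (2 * k) = (v n ^ k)⁻¹ * E.X a n ω ^ (2 * k) := by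
      rw [hy, div_pow, (even_two_mul k).pow_abs, pow_mul (Real.sqrt (v n)), Real.sq_sqrt hvn.le]
      ring
    rw [← Real.mul_rpow hr0 (abs_nonneg _), ← e4]
    calc _ ≤ (Real.sqrt K * y) ^ m :=
          Real.rpow_le_rpow (by positivity) e2 (by linarith)
      _ = K ^ (m / 2) * y ^ m := by
          rw [Real.mul_rpow (by positivity) hy0, Real.sqrt_eq_rpow, ← Real.rpow_mul hK.le]
          congr 2; ring
      _ ≤ _ := mul_le_mul_of_nonneg_left e3 (by positivity)
  rw [← integral_const_mul]
  have iX := (E.integrable_X a n (fun x => x ^ (2 * k))).const_mul (v n ^ k)⁻¹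
  have i1 := (((integrable_const (μ := P) (1 : ℝ)).add iX).const_mul (K ^ (m / 2)))
  have hI := integral_mono (E.integrable_count a n
    (fun j => rate p d n ^ m * |(j : ℝ) / n - 1 / d| ^ m)) i1 hpt
  refine hI.trans ?_
  simp only [Pi.add_apply]
  rw [integral_const_mul, integral_add (integrable_const _) iX, integral_const_mul]
  simp only [integral_const, probReal_univ, smul_eq_mul, mul_one]
  refine mul_le_mul_of_nonneg_left ?_ (by positivity)
  have h := mul_le_mul_of_nonneg_left (hmom n hn) (by positivity : 0 ≤ (v n ^ k)⁻¹)
  have : (v n ^ k)⁻¹ * (A * v n ^ k) = A := by field_simp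
  linarith

end
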